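/- Suppose (A,B,C) ≠ (6,7,10) is a triple of positive integers with A!·B! = C!, A ≤ B ≤ C - 2, and B ≥ 10^6. Then C - B ≤ log log(B+1)/log 2 + 1.819. -/

import Mathlib

open Real

lemma two_pow_sum_digits_le (n : ℕ) : 2 ^ (Nat.digits 2 n).sum ≤ n + 1 := by
  induction n using Nat.strong_induction_on with
  | _ n ih =>
    rcases Nat.eq_zero_or_pos n with rfl | hn
    · simp
    · have h := ih (n / 2) (by omega)
      rw [Nat.digits_def' (by norm_num) hn, List.sum_cons, pow_add]
      rcases Nat.mod_two_eq_zero_or_one n with h0 | h0 <;> rw [h0] <;> omega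

lemma one_le_sum_digits_two {n : ℕ} (hn : 0 < n) : 1 ≤ (Nat.digits 2 n).sum := by
  by_contra! h
  have := sub_one_mul_padicValNat_factorial_lt_of_ne_zero (p := 2) hn.ne'
  have := sub_one_mul_padicValNat_factorial (p := 2) n
  omega

/-- Legendre's formula at `2`, applied to `A! * B! = (B + k)!`. -/
lemma two_pow_le_of_factorial_mul_factorial {A B k : ℕ} (hB : 0 < B)
    (h : A.factorial * B.factorial = (B + k).factorial) :
    2 ^ (A + 1) ≤ 2 ^ k * ((A + 1) * (B + 1)) := by
  have hv := congrArg (padicValNat 2) h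
  rw [padicValNat.mul (Nat.factorial_ne_zero _) (Nat.factorial_ne_zero _)] at hv
  have hA' := sub_one_mul_padicValNat_factorial (p := 2) A
  have hB' := sub_one_mul_padicValNat_factorial (p := 2) B
  have hC' := sub_one_mul_padicValNat_factorial (p := 2) (B + k)
  have hA'' := Nat.digit_sum_le 2 A
  have hB'' := Nat.digit_sum_le 2 B
  have hC'' := Nat.digit_sum_le 2 (B + k)
  have hs := one_le_sum_digits_two (n := B + k) (by omega)
  calc 2 ^ (A + 1) ≤ 2 ^ (k + ((Nat.digits 2 A).sum + (Nat.digits 2 B).sum)) :=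
        Nat.pow_le_pow_right (by norm_num) (by omega)
    _ = 2 ^ k * (2 ^ (Nat.digits 2 A).sum * 2 ^ (Nat.digits 2 B).sum) := by
        rw [pow_add, pow_add]
    _ ≤ _ := by gcongr <;> exact two_pow_sum_digits_le _

lemma log_factorial_le {n : ℕ} (hn : 1 ≤ n) :
    log n.factorial ≤ n * log n - n + log n + 1 := by
  induction n, hn using Nat.le_induction with
  | base => simp
  | succ n hn ih =>
    have hn0 : (0 : ℝ) < n := by exact_mod_cast hn
    have h1 : log (n / (n + 1)) ≤ n / (n + 1) - 1 := log_le_sub_one_of_pos (by positivity)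
    rw [log_div (by positivity) (by positivity)] at h1
    have h2 : (n + 1 : ℝ) * (n / (n + 1) - 1) = -1 := by field_simp; ring
    have h3 := mul_le_mul_of_nonneg_left h1 (by positivity : (0 : ℝ) ≤ n + 1)
    rw [Nat.factorial_succ, Nat.cast_mul, log_mul (by positivity) (by positivity)]
    push_cast
    nlinarith

lemma exp_13_8_le : exp 13.8 ≤ 10 ^ 6 := by
  have h : exp 13.8 ^ 5 ≤ (10 ^ 6) ^ 5 := by
    rw [← exp_nat_mul]
    have : exp ((5 : ℕ) * 13.8) = exp 1 ^ 69 := by rw [← exp_nat_mul]; norm_num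
    rw [this]
    calc exp 1 ^ 69 ≤ 2.7182818286 ^ 69 := by gcongr; exact exp_one_lt_d9.le
      _ ≤ _ := by norm_num
  exact le_of_pow_le_pow_left₀ (by norm_num) (by norm_num) h

lemma log_13_8_le : log 13.8 ≤ 2.625 := by
  rw [log_le_iff_le_exp (by norm_num)]
  have h : (13.8 : ℝ) ^ 8 ≤ exp 2.625 ^ 8 := by
    have : exp 2.625 ^ 8 = exp 1 ^ 21 := by
      rw [← exp_nat_mul, ← exp_nat_mul]; norm_num
    rw [this]
    calc (13.8 : ℝ) ^ 8 ≤ 2.7182818283 ^ 21 := by norm_num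
      _ ≤ _ := by gcongr; exact exp_one_gt_d9.le
  exact le_of_pow_le_pow_left₀ (by norm_num) (by positivity) h

lemma le_log_13_8 : 2.62 ≤ log 13.8 := by
  rw [le_log_iff_exp_le (by norm_num)]
  have h : exp 2.62 ^ 50 ≤ 13.8 ^ 50 := by
    have : exp 2.62 ^ 50 = exp 1 ^ 131 := by
      rw [← exp_nat_mul, ← exp_nat_mul]; norm_num
    rw [this]
    calc exp 1 ^ 131 ≤ 2.7182818286 ^ 131 := by gcongr; exact exp_one_lt_d9.le
      _ ≤ _ := by norm_num
  exact le_of_pow_le_pow_left₀ (by norm_num) (by norm_num) h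

lemma log_2_9_le : log 2.9 ≤ 1.07 := by
  rw [log_le_iff_le_exp (by norm_num)]
  have h : (2.9 : ℝ) ^ 100 ≤ exp 1.07 ^ 100 := by
    have : exp 1.07 ^ 100 = exp 1 ^ 107 := by
      rw [← exp_nat_mul, ← exp_nat_mul]; norm_num
    rw [this]
    calc (2.9 : ℝ) ^ 100 ≤ 2.7182818283 ^ 107 := by norm_num
      _ ≤ _ := by gcongr; exact exp_one_gt_d9.le
  exact le_of_pow_le_pow_left₀ (by norm_num) (by positivity) h

lemma log_le_log_add_div (x c : ℝ) (hx : 0 < x) (hc : 0 < c) :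
    log x ≤ log c + x / c - 1 := by
  have := log_le_sub_one_of_pos (div_pos hx hc)
  rw [log_div hx.ne' hc.ne'] at this
  linarith

/-- A linear upper bound for `a` in terms of `L`. -/
lemma le_four_mul_of_bounds {a k L : ℝ} (ha : 1 ≤ a) (hL : 13.8 ≤ L) (hPL : log (a + 1) ≤ L)
    (h1 : k * L ≤ a * log a - a + log a + 1)
    (h2 : (a + 1 - k) * log 2 ≤ log (a + 1) + L) : a ≤ 4 * L := by
  have hl1 := log_two_gt_d9
  have hl2 := log_two_lt_d9
  have hQP : log a ≤ log (a + 1) := log_le_log (by linarith) (by linarith)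
  have hM' := log_le_log_add_div L 13.8 (by linarith) (by norm_num)
  rw [div_eq_inv_mul] at hM'
  have hM0 := log_13_8_le
  have hP : log (a + 1) ≤ 1.07 + 2 * log L := by
    have h3 : a - 1 ≤ (a + 1 - k) * L := by nlinarith
    have h4 : (a - 1) * log 2 ≤ 2 * L ^ 2 := by nlinarith
    have h5 : a + 1 ≤ 2.9 * L ^ 2 := by nlinarith
    have h6 := log_le_log (by linarith) h5
    rw [log_mul (by norm_num) (by positivity), log_pow] at h6
    have := log_2_9_le
    push_cast at h6
    linarith
  set M := log L
  set P := log (a + 1)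
  set l := log 2
  have h3 : k * L ≤ a * (2 * M + 0.07) + 2 * M + 2.07 := by nlinarith
  by_contra! h
  have hM : 13.8 * M ≤ 22.425 + L := by norm_num at hM' hM0 ⊢; linarith
  have hX : 0.855 * L - 3.32 ≤ L - 2 * M - 0.07 := by linarith
  have h4 : (a + 1) * l * L ≤ l * (a * (2 * M + 0.07) + 2 * M + 2.07) + P * L + L ^ 2 := by
    nlinarith
  have h5 : P * L ≤ (1.07 + 2 * M) * L := by gcongr
  have h6 : a * l * (L - 2 * M - 0.07) ≤ (1.07 + 2 * M) * L + L ^ 2 := by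
    have : 0 ≤ l * (L - 2 * M - 2.07) := mul_nonneg (by linarith) (by linarith)
    nlinarith
  have h7 : 2.772 * L ≤ a * l := by nlinarith
  have h8 : 2.772 * L * (0.855 * L - 3.32) ≤ a * l * (L - 2 * M - 0.07) :=
    mul_le_mul h7 hX (by linarith) (by nlinarith)
  nlinarith

/-- The inequalities `hk` and `hyk` on `y` force `y ≤ α + 1.85 / M`, hence the bound on `k`. -/
lemma le_of_scaled_bounds {k L M l α y : ℝ} (hL : 13.8 ≤ L) (hM62 : 2.62 ≤ M)
    (hM : 13.8 * M ≤ 22.425 + L) (hML : 13.8 * (1 + (M - 2.625) + (M - 2.625) ^ 2 / 2) ≤ L)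
    (hl1 : 0.6931471803 < l) (hl2 : l < 0.6931471808) (hαl : α * l = 1)
    (hy0 : 0 < y) (hy4 : y ≤ 4)
    (hk : k ≤ y * (M + l - 2 + y / 2) + 0.2406 + 0.0363 * y)
    (hyk : y * L + 1 - k ≤ α * (M + l - 0.963 + y / 2 + L)) : k ≤ M * α + 1.819 := by
  have hα1 : 1.4426 ≤ α := by nlinarith
  have hα2 : α ≤ 1.4428 := by nlinarith
  obtain ⟨w, hw⟩ : ∃ w, M * w = 1.85 := ⟨1.85 / M, mul_div_cancel₀ _ (by linarith)⟩
  have hw0 : 0 < w := by by_contra! h; nlinarith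
  have hw1 : w ≤ 0.7062 := by nlinarith
  have hy : y ≤ α + w := by
    by_contra! h
    have h3 : y * (L - M - l + 2 - y / 2 - 0.0363 - α / 2)
        ≤ -1 + 0.2406 + α * (M + l - 0.963 + L) := by linarith
    have h4 : 0 ≤ (y - (α + w)) *
        (L - M - l + 2 - 0.0363 - α / 2 - (y + (α + w)) / 2) :=
      mul_nonneg (by linarith) (by linarith)
    have h5 : (α + w) * (L - M - l + 2 - (α + w) / 2 - 0.0363 - α / 2)
        ≤ -1 + 0.2406 + α * (M + l - 0.963 + L) := by linarith
    have h6 : (α + w) * (l - 2 + (α + w) / 2 + 0.0363 + α / 2) ≤ 1.15 := by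
      have : l - 2 + (α + w) / 2 + 0.0363 + α / 2 ≤ 0.53 := by linarith
      have := mul_le_mul_of_nonneg_left this (by linarith : 0 ≤ α + w)
      linarith
    have h7 : w * L ≤ 2 * α * M + 1.85 + 1.15 - 0.7594 + α * (l - 0.963) := by
      linarith
    have h8 : w * L ≤ 2.8856 * M + 1.852 := by nlinarith
    have h9 : M * (w * L) ≤ M * (2.8856 * M + 1.852) :=
      mul_le_mul_of_nonneg_left h8 (by linarith)
    have h10 : M * (w * L) = 1.85 * L := by linear_combination L * hw
    nlinarith
  have h3 : y * (M + l - 2 + y / 2) + 0.0363 * y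
      ≤ (α + w) * (M + l - 2 + (α + w) / 2) + 0.0363 * (α + w) := by
    have : 0 ≤ (α + w - y) * (M + l - 2 + 0.0363 + (y + (α + w)) / 2) :=
      mul_nonneg (by linarith) (by linarith)
    linarith
  have h4 : (α + w) * (l - 2 + (α + w) / 2) ≤ -0.45 := by
    have h5 : (α + w) * (l - 0.6932) ≤ 0 :=
      mul_nonpos_of_nonneg_of_nonpos (by linarith) (by linarith)
    have h6 : 0 ≤ (α + w - 1.44) * (2.15 - (α + w)) := mul_nonneg (by linarith) (by linarith)
    linarith
  linarith

lemma le_of_log_factorial_bounds {a k L : ℝ} (ha : 1 ≤ a) (hL : 13.8 ≤ L)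
    (hPL : log (a + 1) ≤ L)
    (h1 : k * L ≤ a * log a - a + log a + 1)
    (h2 : (a + 1 - k) * log 2 ≤ log (a + 1) + L) : k ≤ log L / log 2 + 1.819 := by
  have hl1 := log_two_gt_d9
  have hl2 := log_two_lt_d9
  have ha4 := le_four_mul_of_bounds ha hL hPL h1 h2
  have hL0 : 0 < L := by linarith
  have hM0 := log_13_8_le
  have hM0' := le_log_13_8
  have hM : 13.8 * log L ≤ 22.425 + L := by
    have := log_le_log_add_div L 13.8 hL0 (by norm_num)
    rw [div_eq_inv_mul] at this
    norm_num at this hM0 ⊢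
    linarith
  have hQ := log_le_log_add_div a (2 * L) (by linarith) (by linarith)
  have hP := log_le_log_add_div (a + 1) (2 * L) (by linarith) (by linarith)
  rw [log_mul (by norm_num) hL0.ne'] at hQ hP
  have hML : log 13.8 ≤ log L := log_le_log (by norm_num) hL
  have hexp : 13.8 * (1 + (log L - log 13.8) + (log L - log 13.8) ^ 2 / 2) ≤ L := by
    have := quadratic_le_exp_of_nonneg (sub_nonneg.2 hML)
    rw [exp_sub, exp_log hL0, exp_log (by norm_num), le_div_iff₀ (by norm_num)] at this
    linarith
  obtain ⟨α, hα⟩ : ∃ α, α = (log 2)⁻¹ := ⟨_, rfl⟩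
  have hαl : α * log 2 = 1 := by rw [hα]; exact inv_mul_cancel₀ (by linarith)
  rw [div_eq_mul_inv, ← hα]
  generalize log L = M at *
  generalize log (a + 1) = P at *
  generalize log a = Q at *
  generalize log 13.8 = M₀ at *
  generalize log 2 = l at *
  clear hα
  obtain ⟨y, rfl⟩ : ∃ y, a = y * L := ⟨a / L, by field_simp⟩
  have hy0 : 0 < y := by by_contra! h; nlinarith
  have hy4 : y ≤ 4 := by nlinarith
  have e1 : y * L / (2 * L) = y / 2 := by field_simp
  have e2 : (y * L + 1) / (2 * L) = y / 2 + 1 / (2 * L) := by field_simp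
  rw [e1] at hQ
  rw [e2] at hP
  have hLi : 1 / (2 * L) ≤ 0.037 := by
    rw [div_le_iff₀ (by linarith)]; linarith
  -- the two inequalities, rescaled by `L`
  have hk : k ≤ y * (M + l - 2 + y / 2) + 0.2406 + 0.0363 * y := by
    have h3 : k * L ≤ y * L * (M + l - 2 + y / 2) + (M + l + y / 2) := by
      have := mul_le_mul_of_nonneg_left hQ (by linarith : 0 ≤ y * L + 1)
      nlinarith
    have h4 : M + l + y / 2 ≤ (0.2406 + 0.0363 * y) * L := by
      nlinarith
    nlinarith
  have hyk : y * L + 1 - k ≤ α * (M + l - 0.963 + y / 2 + L) := by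
    have h3 : (y * L + 1 - k) * l ≤ M + l - 0.963 + y / 2 + L := by linarith
    have hα0 : 0 ≤ α := by by_contra! h; nlinarith
    calc y * L + 1 - k = α * ((y * L + 1 - k) * l) := by
          linear_combination (-(y * L + 1 - k)) * hαl
      _ ≤ _ := by gcongr
  exact le_of_scaled_bounds hL (hM0'.trans hML) hM (by nlinarith) hl1 hl2 hαl hy0 hy4 hk hyk

theorem bound_C_sub_B (A B C : ℕ) (hA : 0 < A) (hAB : A ≤ B) (hBC : B ≤ C - 2) (hC : 2 ≤ C)
    (h : Nat.factorial A * Nat.factorial B = Nat.factorial C)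
    (hne : (A, B, C) ≠ (6, 7, 10)) (hB : 10 ^ 6 ≤ B) :
    (C : ℝ) - B ≤ Real.log (Real.log (B + 1)) / Real.log 2 + 1.819 := by
  obtain ⟨k, rfl⟩ : ∃ k, C = B + k := ⟨C - B, by omega⟩
  have hBR : (10 : ℝ) ^ 6 ≤ B := by exact_mod_cast hB
  have hAR : (1 : ℝ) ≤ A := by exact_mod_cast hA
  push_cast
  rw [add_sub_cancel_left]
  refine le_of_log_factorial_bounds (a := A) hAR ?_ ?_ ?_ ?_
  · rw [le_log_iff_exp_le (by positivity)]
    linarith [exp_13_8_le]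
  · exact log_le_log (by positivity) (by exact_mod_cast Nat.succ_le_succ hAB)
  · refine le_trans ?_ (log_factorial_le hA)
    have h1 : (B + 1) ^ k ≤ A.factorial := by
      have := Nat.factorial_mul_pow_le_factorial (m := B) (n := k)
      rw [← h, mul_comm] at this
      exact Nat.le_of_mul_le_mul_right this B.factorial_pos
    rw [← log_pow]
    exact log_le_log (by positivity) (by exact_mod_cast h1)
  · have h1 := two_pow_le_of_factorial_mul_factorial (by omega) h
    have h2 : (2 : ℝ) ^ (A + 1) ≤ 2 ^ k * ((A + 1) * (B + 1)) := by exact_mod_cast h1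
    have h3 := log_le_log (by positivity) h2
    rw [log_mul (by positivity) (by positivity), log_mul (by positivity) (by positivity),
      log_pow, log_pow] at h3
    push_cast at h3
    linarith
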